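/- (Stanley, Proposition 12.6.) Let p, q ≥ 1 and let ⪯ be a partial order on [p+q] such that no element of A = {1,…,p} is comparable to any element of B = {p+1,…,p+q}. Then for every s ≥ 0, W_s(⪯) = ∑_{i=0}^{p−1} ∑_{j=0}^{q−1} x^{(s−i)(s−j)} · qbinom(p+j−i, s−i) · qbinom(q+i−j, s−j) · W_i(⪯|_A) · W_j(⪯|_B) in ℤ[x], where qbinom is the Gaussian binomial coefficient in the variable x, with qbinom(n,k) = 0 whenever k < 0 or k > n. -/

import Mathlib

open scoped Classical

/-- The descent set of the word `f 1, …, f n` (1-based positions). -/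
def desSet (n : ℕ) (f : Fin n → ℕ) : Finset ℕ :=
  (Finset.Ico 1 n).filter fun i =>
    ∃ (h1 : i - 1 < n) (h2 : i < n), f ⟨i, h2⟩ < f ⟨i - 1, h1⟩

/-- `W_s ∈ ℤ[x]` for a strict partial order `lt` on an `n`-element labeled set:
the sum of `x^{maj e}` over all linear extensions `e` with exactly `s` descents
(descents taken with respect to the integer labels `lab`). -/
noncomputable def Wpoly (n : ℕ) (lt : Fin n → Fin n → Prop) (lab : Fin n → ℕ)
    (s : ℕ) : Polynomial ℤ :=
  ∑ e ∈ Finset.univ.filter (fun e : Equiv.Perm (Fin n) =>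
      (∀ i j : Fin n, lt (e i) (e j) → i < j) ∧
      (desSet n fun k => lab (e k)).card = s),
    Polynomial.X ^ ((desSet n fun k => lab (e k)).sum id)

/-- `(q)_n = (1-x)(1-x²)⋯(1-xⁿ)`. -/
noncomputable def qpoch (n : ℕ) : Polynomial ℤ :=
  ∏ i ∈ Finset.Icc 1 n, (1 - Polynomial.X ^ i)

/-- The number of descents of the word read from right to left in the list. -/
def revDes {α : Type*} [LinearOrder α] : List α → ℤ
  | [] => 0
  | [_] => 0
  | a :: b :: l => (if a < b then 1 else 0) + revDes (b :: l)

/-- The major index of the word read from right to left in the list. -/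
def revMaj {α : Type*} [LinearOrder α] : List α → ℕ
  | [] => 0
  | [_] => 0
  | a :: b :: l => (if a < b then l.length + 1 else 0) + revMaj (b :: l)

/-- The sum of `f w` over all shuffles `w` of the two lists. -/
def shuffleSum {α M : Type*} [AddCommMonoid M] : (List α → M) → List α → List α → M
  | f, [], v => f v
  | f, a :: u, [] => f (a :: u)
  | f, a :: u, b :: v =>
      shuffleSum (fun w => f (a :: w)) u (b :: v) + shuffleSum (fun w => f (b :: w)) (a :: u) v
termination_by _ u v => u.length + v.length

section Shuffle

variable {α M : Type*} [AddCommMonoid M]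

theorem shuffleSum_nil_left (f : List α → M) (v : List α) : shuffleSum f [] v = f v := by
  rw [shuffleSum]

theorem shuffleSum_nil_right (f : List α → M) (u : List α) : shuffleSum f u [] = f u := by
  cases u <;> rw [shuffleSum]

theorem shuffleSum_cons_cons (f : List α → M) (a b : α) (u v : List α) :
    shuffleSum f (a :: u) (b :: v) =
      shuffleSum (fun w => f (a :: w)) u (b :: v) +
        shuffleSum (fun w => f (b :: w)) (a :: u) v := by
  rw [shuffleSum]

theorem shuffleSum_congr {f g : List α → M} {u v : List α}
    (h : ∀ w : List α, w.Perm (u ++ v) → f w = g w) :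
    shuffleSum f u v = shuffleSum g u v := by
  induction u generalizing f g v with
  | nil => simpa only [shuffleSum_nil_left] using h v (.refl _)
  | cons a u ihu =>
    induction v generalizing f g with
    | nil => simpa only [shuffleSum_nil_right] using h (a :: u) (by simp)
    | cons b v ihv =>
      rw [shuffleSum_cons_cons, shuffleSum_cons_cons]
      congr 1
      · exact ihu fun w hw => h _ (hw.cons a)
      · refine ihv fun w hw => h _ ((hw.cons b).trans ?_)
        exact List.perm_middle.symm

theorem shuffleSum_zero (u v : List α) : shuffleSum (fun _ => (0 : M)) u v = 0 := by
  induction u generalizing v with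
  | nil => rw [shuffleSum_nil_left]
  | cons a u ihu =>
    induction v with
    | nil => rw [shuffleSum_nil_right]
    | cons b v ihv => rw [shuffleSum_cons_cons, ihu, ihv, add_zero]

theorem mul_shuffleSum {R : Type*} [Semiring R] (c : R) (f : List α → R) (u v : List α) :
    shuffleSum (fun w => c * f w) u v = c * shuffleSum f u v := by
  induction u generalizing f v with
  | nil => simp only [shuffleSum_nil_left]
  | cons a u ihu =>
    induction v generalizing f with
    | nil => simp only [shuffleSum_nil_right]
    | cons b v ihv =>
      rw [shuffleSum_cons_cons, shuffleSum_cons_cons, mul_add]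
      exact congr_arg₂ _ (ihu _ _) (ihv _)

theorem shuffleSum_ite_pairwise (R : α → α → Prop) [DecidableRel R] (f : List α → M) (u v : List α)
    (h : ∀ a ∈ u, ∀ b ∈ v, R a b ∧ R b a) :
    shuffleSum (fun w => if w.Pairwise R then f w else 0) u v =
      if u.Pairwise R ∧ v.Pairwise R then shuffleSum f u v else 0 := by
  induction u generalizing f v with
  | nil => simp [shuffleSum_nil_left]
  | cons a u ihu =>
    induction v generalizing f with
    | nil => simp [shuffleSum_nil_right]
    | cons b v ihv =>
      have hA : shuffleSum (fun w => if (a :: w).Pairwise R then f (a :: w) else 0) u (b :: v) =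
          if (a :: u).Pairwise R ∧ (b :: v).Pairwise R then
            shuffleSum (fun w => f (a :: w)) u (b :: v) else 0 := by
        by_cases ha : ∀ y ∈ u, R a y
        · rw [shuffleSum_congr (g := fun w => if w.Pairwise R then f (a :: w) else 0), ihu]
          · exact if_congr (by rw [List.pairwise_cons (a := a), and_iff_right ha]) rfl rfl
          · exact fun a' ha' => h a' (by simp [ha'])
          · intro w hw
            have : ∀ y ∈ w, R a y := by
              intro y hy
              rcases List.mem_append.1 (hw.mem_iff.1 hy) with hy | hy
              · exact ha y hy
              · exact (h a (by simp) y hy).1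
            exact if_congr (by rw [List.pairwise_cons, and_iff_right this]) rfl rfl
        · rw [shuffleSum_congr (g := fun _ => 0), shuffleSum_zero]
          · simp [List.pairwise_cons (a := a), ha]
          · intro w hw
            rw [if_neg]
            intro hp
            exact ha fun y hy => List.rel_of_pairwise_cons hp (hw.mem_iff.2 (by simp [hy]))
      have hB : shuffleSum (fun w => if (b :: w).Pairwise R then f (b :: w) else 0) (a :: u) v =
          if (a :: u).Pairwise R ∧ (b :: v).Pairwise R then
            shuffleSum (fun w => f (b :: w)) (a :: u) v else 0 := by
        by_cases hb : ∀ y ∈ v, R b y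
        · rw [shuffleSum_congr (g := fun w => if w.Pairwise R then f (b :: w) else 0), ihv]
          · exact if_congr (by rw [List.pairwise_cons (a := b), and_iff_right hb]) rfl rfl
          · exact fun a' ha' b' hb' => h a' ha' b' (by simp [hb'])
          · intro w hw
            have : ∀ y ∈ w, R b y := by
              intro y hy
              rcases List.mem_append.1 (hw.mem_iff.1 hy) with hy | hy
              · exact (h y hy b (by simp)).2
              · exact hb y hy
            exact if_congr (by rw [List.pairwise_cons, and_iff_right this]) rfl rfl
        · rw [shuffleSum_congr (g := fun _ => 0), shuffleSum_zero]
          · simp [List.pairwise_cons (a := b), hb]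
          · intro w hw
            rw [if_neg]
            intro hp
            exact hb fun y hy => List.rel_of_pairwise_cons hp (hw.mem_iff.2 (by simp [hy]))
      rw [shuffleSum_cons_cons, hA, hB, shuffleSum_cons_cons]
      split_ifs <;> simp

/-- The words that use each element of `S` exactly once. -/
noncomputable def words (S : Finset α) : Finset (List α) :=
  S.val.lists.toFinset

theorem mem_words {S : Finset α} {l : List α} : l ∈ words S ↔ S.val = l := by
  simp [words, Multiset.mem_lists_iff]

theorem words_empty : words (∅ : Finset α) = {[]} := by
  ext l
  simp [mem_words, eq_comm]

theorem sum_words_eq_sum_cons [DecidableEq α] {S : Finset α} (hS : S.Nonempty) (f : List α → M) :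
    ∑ l ∈ words S, f l = ∑ t ∈ S, ∑ r ∈ words (S.erase t), f (t :: r) := by
  rw [Finset.sum_sigma']
  symm
  refine Finset.sum_bij (fun x _ => x.1 :: x.2) ?_ ?_ ?_ ?_
  · rintro ⟨t, r⟩ h
    simp only [Finset.mem_sigma, mem_words] at h ⊢
    rw [← Multiset.cons_coe, ← h.2, Finset.erase_val]
    exact (Multiset.cons_erase h.1).symm
  · rintro ⟨t, r⟩ _ ⟨t', r'⟩ _ h
    simpa using h
  · intro l hl
    rw [mem_words] at hl
    cases l with
    | nil => simp at hl; simp [hl] at hS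
    | cons t r =>
      refine ⟨⟨t, r⟩, ?_, rfl⟩
      have ht : t ∈ S := by
        rw [← Finset.mem_val, hl]; simp
      simp only [Finset.mem_sigma, mem_words, Finset.erase_val, hl]
      exact ⟨ht, by simp⟩
  · intros; rfl

theorem sum_words_union [DecidableEq α] {A B : Finset α} (hAB : Disjoint A B) (f : List α → M) :
    ∑ w ∈ words (A ∪ B), f w =
      ∑ u ∈ words A, ∑ v ∈ words B, shuffleSum f u v := by
  induction hn : A.card + B.card generalizing A B f with
  | zero =>
    obtain ⟨rfl, rfl⟩ : A = ∅ ∧ B = ∅ := by simpa using hn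
    simp [words_empty, shuffleSum_nil_left]
  | succ n ih =>
    rcases A.eq_empty_or_nonempty with rfl | hA
    · simp [words_empty, shuffleSum_nil_left]
    rcases B.eq_empty_or_nonempty with rfl | hB
    · simp [words_empty, shuffleSum_nil_right]
    have h1 : ∀ t ∈ A, ∑ r ∈ words ((A ∪ B).erase t), f (t :: r) =
        ∑ u ∈ words (A.erase t), ∑ v ∈ words B,
          shuffleSum (fun w => f (t :: w)) u v := by
      intro t ht
      rw [Finset.erase_union_distrib, Finset.erase_eq_of_notMem (Finset.disjoint_left.1 hAB ht)]
      refine ih (hAB.mono_left (Finset.erase_subset _ _)) _ ?_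
      have := Finset.card_erase_add_one ht
      omega
    have h2 : ∀ t ∈ B, ∑ r ∈ words ((A ∪ B).erase t), f (t :: r) =
        ∑ u ∈ words A, ∑ v ∈ words (B.erase t),
          shuffleSum (fun w => f (t :: w)) u v := by
      intro t ht
      rw [Finset.erase_union_distrib,
        Finset.erase_eq_of_notMem (Finset.disjoint_right.1 hAB ht)]
      refine ih (hAB.mono_right (Finset.erase_subset _ _)) _ ?_
      have := Finset.card_erase_add_one ht
      omega
    rw [sum_words_eq_sum_cons (hA.mono Finset.subset_union_left), Finset.sum_union hAB,
      Finset.sum_congr rfl h1, Finset.sum_congr rfl h2]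
    simp_rw [sum_words_eq_sum_cons hA, sum_words_eq_sum_cons hB, shuffleSum_cons_cons,
      Finset.sum_add_distrib]
    congr 1
    rw [Finset.sum_comm]
    refine Finset.sum_congr rfl fun a _ => ?_
    rw [Finset.sum_comm]

end Shuffle

theorem qpoch_succ (n : ℕ) : qpoch (n + 1) = qpoch n * (1 - Polynomial.X ^ (n + 1)) := by
  rw [qpoch, qpoch, Finset.prod_Icc_succ_top (by omega)]

theorem qpoch_ne_zero (n : ℕ) : qpoch n ≠ 0 := by
  refine Finset.prod_ne_zero_iff.2 fun i hi h => ?_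
  have := congr_arg (Polynomial.eval 0) h
  have hi' : i ≠ 0 := by have := Finset.mem_Icc.1 hi; omega
  simp [hi'] at this

section Descents

variable {α : Type*} [LinearOrder α]

theorem revDes_cons_cons (a b : α) (l : List α) :
    revDes (a :: b :: l) = (if a < b then 1 else 0) + revDes (b :: l) := by
  rw [revDes]

theorem revMaj_cons_cons (a b : α) (l : List α) :
    revMaj (a :: b :: l) = (if a < b then l.length + 1 else 0) + revMaj (b :: l) := by
  rw [revMaj]

theorem revDes_nonneg (l : List α) : 0 ≤ revDes l := by
  induction l with
  | nil => simp [revDes]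
  | cons a l ih =>
    cases l with
    | nil => simp [revDes]
    | cons b l => rw [revDes_cons_cons]; split_ifs <;> omega

theorem revDes_cons_le (a : α) (l : List α) : revDes (a :: l) ≤ l.length := by
  induction l generalizing a with
  | nil => simp [revDes]
  | cons b l ih =>
    have := ih b
    rw [revDes_cons_cons, List.length_cons]
    split_ifs <;> push_cast <;> omega

theorem revDes_revMaj_reverse_ofFn {n : ℕ} (h : Fin n → α) (f : Fin n → ℕ)
    (hf : ∀ i j, f i < f j ↔ h i < h j) :
    revDes (List.ofFn h).reverse = (desSet n f).card ∧
      revMaj (List.ofFn h).reverse = (desSet n f).sum id := by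
  induction n with
  | zero => simp [desSet, revDes, revMaj]
  | succ n ih =>
    cases n with
    | zero => simp [desSet, revDes, revMaj]
    | succ n =>
      obtain ⟨ih1, ih2⟩ := ih (fun i => h i.castSucc) (fun i => f i.castSucc)
        fun i j => hf _ _
      have hset : desSet (n + 2) f =
          if f (Fin.last (n + 1)) < f (Fin.last n).castSucc then
            insert (n + 1) (desSet (n + 1) fun i => f i.castSucc)
          else desSet (n + 1) fun i => f i.castSucc := by
        have hmem : ∀ i, i ∈ desSet (n + 2) f ↔
            (i = n + 1 ∧ f (Fin.last (n + 1)) < f (Fin.last n).castSucc) ∨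
              i ∈ desSet (n + 1) fun i => f i.castSucc := by
          intro i
          simp only [desSet, Finset.mem_filter, Finset.mem_Ico]
          constructor
          · rintro ⟨⟨hi1, hi2⟩, h1, h2, h3⟩
            by_cases hi : i = n + 1
            · subst hi
              exact Or.inl ⟨rfl, h3⟩
            · exact Or.inr ⟨⟨hi1, by omega⟩, by omega, by omega, h3⟩
          · rintro (⟨rfl, h3⟩ | ⟨⟨hi1, hi2⟩, h1, h2, h3⟩)
            · exact ⟨⟨by omega, by omega⟩, by omega, by omega, h3⟩
            · exact ⟨⟨hi1, by omega⟩, by omega, by omega, h3⟩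
        ext i
        rw [hmem]
        split_ifs with hd <;> simp [hd]
      have hnot : n + 1 ∉ desSet (n + 1) fun i => f i.castSucc := by
        simp [desSet]
      have hlist : (List.ofFn h).reverse = h (Fin.last (n + 1)) :: h (Fin.last n).castSucc ::
          (List.ofFn fun i : Fin n => h i.castSucc.castSucc).reverse := by
        rw [List.ofFn_succ', List.ofFn_succ']
        simp [List.concat_eq_append]
      have hlist' : (List.ofFn fun i : Fin (n + 1) => h i.castSucc).reverse =
          h (Fin.last n).castSucc ::
            (List.ofFn fun i : Fin n => h i.castSucc.castSucc).reverse := by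
        rw [List.ofFn_succ']
        simp [List.concat_eq_append]
      rw [hlist, revDes_cons_cons, revMaj_cons_cons, ← hlist', ih1, ih2, hset]
      simp only [hf]
      split_ifs
      · rw [Finset.card_insert_of_notMem hnot, Finset.sum_insert hnot]
        simp [add_comm]
      · simp

/-- The contribution `x ^ maj` of a word to the sum over words with `s` descents. -/
noncomputable def descentTerm {K : Type*} [Semiring K] (x : K) (s : ℤ) (l : List α) : K :=
  if revDes l = s then x ^ revMaj l else 0

theorem Wpoly_eq_sum_words {n : ℕ} (lt : α → α → Prop) [Std.Irrefl lt] (g : Fin n ↪ α)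
    (lab : Fin n → ℕ) (hg : ∀ i j, lab i < lab j ↔ g i < g j) (s : ℕ) :
    Wpoly n (fun a b => lt (g a) (g b)) lab s =
      ∑ l ∈ words (Finset.univ.map g),
        if l.Pairwise (fun a b => ¬ lt a b) then descentTerm Polynomial.X s l else 0 := by
  rw [Wpoly, Finset.sum_filter]
  refine Finset.sum_bij (fun e _ => (List.ofFn fun i => g (e i)).reverse) ?_ ?_ ?_ ?_
  · intro e _
    rw [mem_words]
    have : (List.ofFn fun i => g (e i)).Nodup :=
      List.nodup_ofFn.2 (g.injective.comp e.injective)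
    refine (Multiset.Nodup.ext (Finset.nodup _) (by simpa using this)).2 fun a => ?_
    simp only [Finset.mem_val, Finset.mem_map, Finset.mem_univ, true_and, Multiset.mem_coe,
      List.mem_reverse, List.mem_ofFn]
    exact (e.surjective.exists (p := fun i => g i = a))
  · intro e _ e' _ h
    have h := List.ofFn_injective (List.reverse_injective h)
    exact Equiv.ext fun i => g.injective (congr_fun h i)
  · intro l hl
    rw [mem_words] at hl
    have hnd : l.Nodup := by
      rw [← Multiset.coe_nodup, ← hl]; exact Finset.nodup _
    have hlen : l.reverse.length = n := by
      have := congr_arg Multiset.card hl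
      simpa using this.symm
    have hex : ∀ i : Fin n, ∃ j : Fin n, g j = l.reverse.get (i.cast hlen.symm) := by
      intro i
      have : l.reverse.get (i.cast hlen.symm) ∈ (Finset.univ.map g).val := by
        rw [hl, Multiset.mem_coe, ← List.mem_reverse]
        exact List.get_mem _ _
      simpa using this
    choose e he using hex
    have hinj : Function.Injective e := by
      intro i j hij
      have h := he i
      rw [hij, he j] at h
      have := (List.nodup_iff_injective_get.1 (List.nodup_reverse.2 hnd)) h
      simpa using this.symm
    refine ⟨Equiv.ofBijective e (Finite.injective_iff_bijective.1 hinj), Finset.mem_univ _, ?_⟩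
    simp only [Equiv.ofBijective_apply, he]
    rw [List.reverse_eq_iff]
    subst hlen
    exact List.ofFn_get _
  · intro e _
    obtain ⟨h1, h2⟩ := revDes_revMaj_reverse_ofFn (fun i => g (e i)) (fun i => lab (e i))
      fun i j => hg _ _
    have hpw : (List.ofFn fun i => g (e i)).reverse.Pairwise (fun a b => ¬ lt a b) ↔
        ∀ i j, lt (g (e i)) (g (e j)) → i < j := by
      rw [List.pairwise_reverse, List.pairwise_ofFn]
      constructor
      · intro h i j hij
        rcases lt_trichotomy i j with hlt | rfl | hlt
        · exact hlt
        · exact (irrefl _ hij).elim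
        · exact (h hlt hij).elim
      · intro h i j hij hlt
        exact absurd (h j i hlt) (not_lt.2 hij.le)
    rw [descentTerm, h1, h2, ← ite_and]
    exact if_congr (by rw [hpw, Nat.cast_inj]) rfl rfl

end Descents

/-- The family `G n k` satisfies the Pascal rule and the boundary conditions of the Gaussian
binomial coefficients at `x`. -/
structure IsGaussBinom {K : Type*} [Field K] (x : K) (G : ℤ → ℤ → K) : Prop where
  pascal : ∀ n k, 1 ≤ n → G n k = G (n - 1) k + x ^ (n - k) * G (n - 1) (k - 1)
  eq_zero_of_neg : ∀ n k, 0 ≤ n → k < 0 → G n k = 0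
  eq_zero_of_lt : ∀ n k, 0 ≤ n → n < k → G n k = 0
  zero_right : ∀ n, 0 ≤ n → G n 0 = 1
  self : ∀ n, 0 ≤ n → G n n = 1

section Shuffling

variable {K : Type*} [Field K] {x : K} {G : ℤ → ℤ → K}

/-- The coefficient of Stanley's shuffling theorem: all shuffles with `s` descents of words of
lengths `p`, `q` with `i`, `j` descents. -/
def shuffleCoeff (x : K) (G : ℤ → ℤ → K) (p q i j s : ℤ) : K :=
  x ^ ((s - i) * (s - j)) * G (p + j - i) (s - i) * G (q + i - j) (s - j)

/-- The part of `shuffleCoeff` from the shuffles ending in a letter of the first word. -/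
def shuffleCoeffFst (x : K) (G : ℤ → ℤ → K) (p q i j s : ℤ) : K :=
  x ^ ((s - i) * (s - j) + (q + i - s)) * G (p + j - i) (s - i) * G (q + i - j - 1) (s - j - 1)

/-- The part of `shuffleCoeff` from the shuffles ending in a letter of the second word. -/
def shuffleCoeffSnd (x : K) (G : ℤ → ℤ → K) (p q i j s : ℤ) : K :=
  x ^ ((s - i) * (s - j)) * G (p + j - i) (s - i) * G (q + i - j - 1) (s - j)

theorem shuffleCoeffFst_add_snd (hx : x ≠ 0) (hG : IsGaussBinom x G) {p q i j s : ℤ}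
    (h : 1 ≤ q + i - j) :
    shuffleCoeffFst x G p q i j s + shuffleCoeffSnd x G p q i j s =
      shuffleCoeff x G p q i j s := by
  have key : x ^ ((s - i) * (s - j) + (q + i - s)) =
      x ^ ((s - i) * (s - j)) * x ^ (q + i - j - (s - j)) := by
    rw [← zpow_add₀ hx]; congr 1; ring
  rw [shuffleCoeffFst, shuffleCoeffSnd, shuffleCoeff, hG.pascal _ (s - j) h, key]
  ring

theorem shuffleCoeffFst_of_not_descent (hx : x ≠ 0) (hG : IsGaussBinom x G) {p q i j s : ℤ}
    (h : 1 ≤ p + 1 + j - i) :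
    shuffleCoeffFst x G p q i j s + x ^ (p + q) * shuffleCoeffSnd x G p q i j (s - 1) =
      shuffleCoeffFst x G (p + 1) q i j s := by
  have key : x ^ (p + q) * x ^ ((s - 1 - i) * (s - 1 - j)) =
      x ^ ((s - i) * (s - j) + (q + i - s)) * x ^ (p + 1 + j - i - (s - i)) := by
    rw [← zpow_add₀ hx, ← zpow_add₀ hx]; congr 1; ring
  rw [shuffleCoeffFst, shuffleCoeffSnd, shuffleCoeffFst, hG.pascal _ (s - i) h,
    show p + 1 + j - i - 1 = p + j - i by ring, show s - 1 - i = s - i - 1 by ring,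
    show s - 1 - j = s - j - 1 by ring]
  rw [show s - 1 - i = s - i - 1 by ring, show s - 1 - j = s - j - 1 by ring] at key
  linear_combination G (p + j - i) (s - i - 1) * G (q + i - j - 1) (s - j - 1) * key

theorem shuffleCoeffFst_of_descent (hx : x ≠ 0) {p q i j s : ℤ} :
    x ^ (p + q) * shuffleCoeff x G p q i j (s - 1) =
      x ^ p * shuffleCoeffFst x G (p + 1) q (1 + i) j s := by
  have key : x ^ (p + q) * x ^ ((s - 1 - i) * (s - 1 - j)) =
      x ^ p * x ^ ((s - (1 + i)) * (s - j) + (q + (1 + i) - s)) := by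
    rw [← zpow_add₀ hx, ← zpow_add₀ hx]; congr 1; ring
  rw [shuffleCoeff, shuffleCoeffFst, show p + 1 + j - (1 + i) = p + j - i by ring,
    show s - (1 + i) = s - 1 - i by ring, show q + (1 + i) - j - 1 = q + i - j by ring,
    show s - j - 1 = s - 1 - j by ring]
  rw [show s - (1 + i) = s - 1 - i by ring] at key
  linear_combination G (p + j - i) (s - 1 - i) * G (q + i - j) (s - 1 - j) * key

theorem shuffleCoeffSnd_of_not_descent {p q i j s : ℤ} :
    shuffleCoeff x G p q i j s = shuffleCoeffSnd x G p (q + 1) i j s := by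
  rw [shuffleCoeff, shuffleCoeffSnd, show q + 1 + i - j - 1 = q + i - j by ring]

theorem shuffleCoeffSnd_of_descent (hx : x ≠ 0) (hG : IsGaussBinom x G) {p q i j s : ℤ}
    (h : 1 ≤ p + (1 + j) - i) :
    shuffleCoeffFst x G p q i j s + x ^ (p + q) * shuffleCoeffSnd x G p q i j (s - 1) =
      x ^ q * shuffleCoeffSnd x G p (q + 1) i (1 + j) s := by
  have key1 : x ^ ((s - i) * (s - j) + (q + i - s)) = x ^ q * x ^ ((s - i) * (s - (1 + j))) := by
    rw [← zpow_add₀ hx]; congr 1; ring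
  have key2 : x ^ (p + q) * x ^ ((s - 1 - i) * (s - 1 - j)) =
      x ^ q * x ^ ((s - i) * (s - (1 + j))) * x ^ (p + (1 + j) - i - (s - i)) := by
    rw [← zpow_add₀ hx, ← zpow_add₀ hx, ← zpow_add₀ hx]; congr 1; ring
  rw [shuffleCoeffFst, shuffleCoeffSnd, shuffleCoeffSnd, hG.pascal _ (s - i) h, key1,
    show p + (1 + j) - i - 1 = p + j - i by ring,
    show q + 1 + i - (1 + j) - 1 = q + i - j - 1 by ring,
    show s - j - 1 = s - (1 + j) by ring, show s - i - 1 = s - 1 - i by ring]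
  rw [show s - 1 - j = s - (1 + j) by ring] at key2 ⊢
  linear_combination G (p + j - i) (s - 1 - i) * G (q + i - j - 1) (s - (1 + j)) * key2

theorem shuffleCoeffSnd_zero_left (hG : IsGaussBinom x G) {q j s : ℤ} (h0 : 0 ≤ j)
    (h1 : j < q) : shuffleCoeffSnd x G 0 q 0 j s = if j = s then 1 else 0 := by
  rw [shuffleCoeffSnd]
  rcases lt_trichotomy s j with h | rfl | h
  · rw [if_neg h.ne', hG.eq_zero_of_neg (q + 0 - j - 1) (s - j) (by omega) (by omega), mul_zero]
  · rw [if_pos rfl, sub_self, show 0 + s - 0 = s by ring, sub_zero, hG.self s h0,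
      hG.zero_right _ (by omega)]
    simp
  · rw [if_neg h.ne, hG.eq_zero_of_lt (0 + j - 0) (s - 0) (by omega) (by omega)]
    simp

theorem shuffleCoeffSnd_one_right (hG : IsGaussBinom x G) {p i s : ℤ} (h0 : 0 ≤ i)
    (h1 : i ≤ p) : shuffleCoeffSnd x G p 1 i 0 s = if i = s then 1 else 0 := by
  rw [shuffleCoeffSnd]
  rcases lt_trichotomy s i with h | rfl | h
  · rw [if_neg h.ne', hG.eq_zero_of_neg (p + 0 - i) (s - i) (by omega) (by omega)]
    simp
  · rw [if_pos rfl, sub_self, show 1 + s - 0 - 1 = s by ring, sub_zero, hG.self s h0,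
      hG.zero_right _ (by omega)]
    simp
  · rw [if_neg h.ne, hG.eq_zero_of_lt (1 + i - 0 - 1) (s - 0) (by omega) (by omega), mul_zero]

theorem shuffleCoeffFst_one_left (hG : IsGaussBinom x G) {q j s : ℤ} (h0 : 0 ≤ j)
    (h1 : j < q) : shuffleCoeffFst x G 1 q 0 j s = if j = s - 1 then x ^ q else 0 := by
  rw [shuffleCoeffFst]
  rcases lt_trichotomy (s - 1) j with h | rfl | h
  · rw [if_neg h.ne', hG.eq_zero_of_neg (q + 0 - j - 1) (s - j - 1) (by omega) (by omega),
      mul_zero]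
  · rw [if_pos rfl, show 1 + (s - 1) - 0 = s by ring, show s - (s - 1) - 1 = 0 by ring, sub_zero,
      hG.self s (by omega), hG.zero_right _ (by omega), mul_one, mul_one]
    congr 1
    ring
  · rw [if_neg h.ne, hG.eq_zero_of_lt (1 + j - 0) (s - 0) (by omega) (by omega)]
    simp

variable {α : Type*} [LinearOrder α]

theorem descentTerm_cons_of_lt {a b : α} (h : a < b) (l : List α) (s : ℤ) :
    descentTerm x s (a :: b :: l) = x ^ (l.length + 1) * descentTerm x (s - 1) (b :: l) := by
  simp only [descentTerm, revDes_cons_cons, revMaj_cons_cons, if_pos h, pow_add, mul_ite, mul_zero]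
  exact if_congr (by omega) rfl rfl

theorem descentTerm_cons_of_not_lt {a b : α} (h : ¬ a < b) (l : List α) (s : ℤ) :
    descentTerm x s (a :: b :: l) = descentTerm x s (b :: l) := by
  simp only [descentTerm, revDes_cons_cons, revMaj_cons_cons, if_neg h, zero_add]

theorem shuffleSum_descentTerm_cons_of_lt {a b : α} (h : a < b) (u v : List α) (s : ℤ) :
    shuffleSum (fun w => descentTerm x s (a :: b :: w)) u v =
      x ^ ((u.length : ℤ) + v.length + 1) *
        shuffleSum (fun w => descentTerm x (s - 1) (b :: w)) u v := by
  rw [← mul_shuffleSum]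
  refine shuffleSum_congr fun w hw => ?_
  rw [descentTerm_cons_of_lt h, hw.length_eq, List.length_append, ← zpow_natCast]
  push_cast
  rfl

theorem shuffleSum_descentTerm_cons_of_not_lt {a b : α} (h : ¬ a < b) (u v : List α) (s : ℤ) :
    shuffleSum (fun w => descentTerm x s (a :: b :: w)) u v =
      shuffleSum (fun w => descentTerm x s (b :: w)) u v :=
  shuffleSum_congr fun w _ => descentTerm_cons_of_not_lt h w s

theorem shuffleSum_descentTerm_cons (hx : x ≠ 0) (hG : IsGaussBinom x G) (n : ℕ) :
    (∀ (a : α) (u : List α) (b : α) (v : List α) (s : ℤ), u.length + v.length + 2 ≤ n →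
      (∀ y ∈ a :: u, ∀ z ∈ b :: v, y < z) →
      shuffleSum (fun w => descentTerm x s (a :: w)) u (b :: v) =
        x ^ (revMaj (a :: u) + revMaj (b :: v)) *
          shuffleCoeffFst x G (u.length + 1) (v.length + 1) (revDes (a :: u)) (revDes (b :: v))
            s) ∧
    (∀ (u : List α) (b : α) (v : List α) (s : ℤ), u.length + v.length + 1 ≤ n →
      (∀ y ∈ u, ∀ z ∈ b :: v, y < z) →
      shuffleSum (fun w => descentTerm x s (b :: w)) u v =
        x ^ (revMaj u + revMaj (b :: v)) *
          shuffleCoeffSnd x G u.length (v.length + 1) (revDes u) (revDes (b :: v)) s) := by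
  induction n with
  | zero => exact ⟨fun _ _ _ _ _ h => by omega, fun _ _ _ _ h => by omega⟩
  | succ n ih =>
    obtain ⟨ihA, ihB⟩ := ih
    constructor
    · intro a u b v s hn hlt
      have hv0 := revDes_nonneg (b :: v)
      have hv1 := revDes_cons_le b v
      cases u with
      | nil =>
        have := shuffleCoeffFst_one_left (x := x) hG (q := v.length + 1) (s := s) hv0 (by omega)
        rw [shuffleSum_nil_left, descentTerm_cons_of_lt (hlt a (by simp) b (by simp)),
          descentTerm]
        simp only [List.length_nil, Nat.cast_zero, zero_add, revDes, revMaj]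
        rw [this, mul_ite, mul_ite, mul_zero, mul_zero, mul_comm, ← zpow_natCast x (_ + 1)]
        push_cast
        rfl
      | cons a' u =>
        have hu1 := revDes_cons_le a' u
        have hu0 := revDes_nonneg (a' :: u)
        simp only [List.length_cons] at hn
        have hlt' : ∀ y ∈ a' :: u, ∀ z ∈ b :: v, y < z := fun y hy =>
          hlt y (List.mem_cons_of_mem _ hy)
        have eA := fun s => ihA a' u b v s (by omega) hlt'
        have eB := fun s => ihB (a' :: u) b v s (by rw [List.length_cons]; omega) hlt'
        rw [shuffleSum_cons_cons,
          shuffleSum_descentTerm_cons_of_lt (hlt a (by simp) b (by simp)), eB, revDes_cons_cons,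
          revMaj_cons_cons]
        by_cases h : a < a'
        · rw [shuffleSum_descentTerm_cons_of_lt h, eA, if_pos h, if_pos h]
          have e1 := shuffleCoeffFst_add_snd (p := u.length + 1) (s := s - 1) hx hG
            (show 1 ≤ (v.length + 1 : ℤ) + revDes (a' :: u) - revDes (b :: v) by omega)
          have e2 := shuffleCoeffFst_of_descent (G := G) hx (p := u.length + 1)
            (q := v.length + 1) (i := revDes (a' :: u)) (j := revDes (b :: v)) (s := s)
          rw [← e1] at e2
          simp only [List.length_cons, pow_add, ← zpow_natCast x (u.length), pow_one]
          push_cast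
          rw [show (u.length : ℤ) + (v.length + 1) + 1 = u.length + 1 + (v.length + 1) by ring,
            show (u.length : ℤ) + 1 + v.length + 1 = u.length + 1 + (v.length + 1) by ring]
          rw [zpow_add₀ hx u.length 1, zpow_one] at e2
          linear_combination x ^ revMaj (a' :: u) * x ^ revMaj (b :: v) * e2
        · rw [shuffleSum_descentTerm_cons_of_not_lt h, eA, if_neg h, if_neg h]
          have e2 := shuffleCoeffFst_of_not_descent hx hG (p := u.length + 1)
            (q := v.length + 1) (i := revDes (a' :: u)) (j := revDes (b :: v)) (s := s) (by omega)
          simp only [List.length_cons, zero_add]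
          push_cast
          rw [show (u.length : ℤ) + 1 + v.length + 1 = u.length + 1 + (v.length + 1) by ring,
            ← e2]
          ring
    · intro u b v s hn hlt
      cases v with
      | nil =>
        rw [shuffleSum_nil_right]
        have hu0 := revDes_nonneg u
        simp only [List.length_nil, Nat.cast_zero, zero_add, revDes, revMaj]
        have hu1 : revDes u ≤ u.length := by
          cases u with
          | nil => simp [revDes]
          | cons a u => have := revDes_cons_le a u; rw [List.length_cons]; push_cast; omega
        rw [shuffleCoeffSnd_one_right hG hu0 hu1]
        cases u with
        | nil =>
          by_cases h : (0 : ℤ) = s <;> simp [descentTerm, revDes, revMaj, h]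
        | cons a u =>
          rw [descentTerm_cons_of_not_lt (hlt a (by simp) b (by simp)).not_gt, descentTerm]
          simp
      | cons b' v =>
        have hv0 := revDes_nonneg (b' :: v)
        have hv1 := revDes_cons_le b' v
        cases u with
        | nil =>
          rw [shuffleSum_nil_left]
          have h0 := revDes_nonneg (b :: b' :: v)
          have h1 := revDes_cons_le b (b' :: v)
          have : revDes ([] : List α) = 0 := rfl
          rw [this, List.length_nil, Nat.cast_zero,
            shuffleCoeffSnd_zero_left hG h0 (by omega), descentTerm]
          simp [revMaj]
        | cons a u =>
          have hu0 := revDes_nonneg (a :: u)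
          have hu1 := revDes_cons_le a u
          simp only [List.length_cons] at hn
          have hlt' : ∀ y ∈ a :: u, ∀ z ∈ b' :: v, y < z := fun y hy z hz =>
            hlt y hy z (List.mem_cons_of_mem _ hz)
          have eA := fun s => ihA a u b' v s (by omega) hlt'
          have eB := fun s => ihB (a :: u) b' v s (by rw [List.length_cons]; omega) hlt'
          rw [shuffleSum_cons_cons, shuffleSum_descentTerm_cons_of_not_lt
            (hlt a (by simp) b (by simp)).not_gt, eA, revDes_cons_cons, revMaj_cons_cons]
          by_cases h : b < b'
          · rw [shuffleSum_descentTerm_cons_of_lt h, eB, if_pos h, if_pos h]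
            have e2 := shuffleCoeffSnd_of_descent hx hG (p := u.length + 1)
              (q := v.length + 1) (i := revDes (a :: u)) (j := revDes (b' :: v)) (s := s)
              (by omega)
            simp only [List.length_cons, pow_add, ← zpow_natCast x (v.length), pow_one]
            push_cast
            rw [show (u.length : ℤ) + 1 + v.length + 1 = u.length + 1 + (v.length + 1) by ring]
            rw [zpow_add₀ hx v.length 1, zpow_one] at e2
            linear_combination x ^ revMaj (a :: u) * x ^ revMaj (b' :: v) * e2
          · rw [shuffleSum_descentTerm_cons_of_not_lt h, eB, if_neg h, if_neg h]
            have e1 := shuffleCoeffFst_add_snd (p := u.length + 1) (s := s) hx hG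
              (show 1 ≤ (v.length + 1 : ℤ) + revDes (a :: u) - revDes (b' :: v) by omega)
            rw [shuffleCoeffSnd_of_not_descent] at e1
            simp only [List.length_cons, zero_add]
            push_cast
            rw [← e1]
            ring

theorem shuffleSum_descentTerm (hx : x ≠ 0) (hG : IsGaussBinom x G) {u v : List α}
    (hu : u ≠ []) (hv : v ≠ []) (hlt : ∀ y ∈ u, ∀ z ∈ v, y < z) (s : ℤ) :
    shuffleSum (descentTerm x s) u v = x ^ (revMaj u + revMaj v) *
      shuffleCoeff x G u.length v.length (revDes u) (revDes v) s := by
  obtain ⟨a, u, rfl⟩ := List.exists_cons_of_ne_nil hu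
  obtain ⟨b, v, rfl⟩ := List.exists_cons_of_ne_nil hv
  have hu0 := revDes_nonneg (a :: u)
  have hv1 := revDes_cons_le b v
  obtain ⟨hA, hB⟩ := shuffleSum_descentTerm_cons (α := α) hx hG (u.length + v.length + 2)
  rw [shuffleSum_cons_cons, hA a u b v s le_rfl hlt,
    hB (a :: u) b v s (by rw [List.length_cons]; omega) hlt, ← mul_add, List.length_cons,
    List.length_cons]
  push_cast
  rw [shuffleCoeffFst_add_snd hx hG (by omega)]

end Shuffling

section GaussBinom

variable {qbinom : ℕ → ℤ → Polynomial ℤ}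

theorem qbinom_zero_right
    (hqb1 : ∀ n k : ℕ, k ≤ n → qbinom n k * (qpoch k * qpoch (n - k)) = qpoch n) (n : ℕ) :
    qbinom n 0 = 1 := by
  have h := hqb1 n 0 (Nat.zero_le n)
  refine mul_right_cancel₀ (qpoch_ne_zero n) ?_
  simpa [qpoch] using h

theorem qbinom_self
    (hqb1 : ∀ n k : ℕ, k ≤ n → qbinom n k * (qpoch k * qpoch (n - k)) = qpoch n) (n : ℕ) :
    qbinom n n = 1 := by
  have h := hqb1 n n le_rfl
  refine mul_right_cancel₀ (qpoch_ne_zero n) ?_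
  simpa [qpoch] using h

theorem qbinom_succ_succ
    (hqb1 : ∀ n k : ℕ, k ≤ n → qbinom n k * (qpoch k * qpoch (n - k)) = qpoch n)
    (k m : ℕ) :
    qbinom (k + m + 2) ((k + 1 : ℕ) : ℤ) = qbinom (k + m + 1) ((k + 1 : ℕ) : ℤ) +
      Polynomial.X ^ (m + 1) * qbinom (k + m + 1) (k : ℤ) := by
  have h1 := hqb1 (k + m + 2) (k + 1) (by omega)
  have h2 := hqb1 (k + m + 1) (k + 1) (by omega)
  have h3 := hqb1 (k + m + 1) k (by omega)
  rw [show k + m + 2 - (k + 1) = m + 1 by omega] at h1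
  rw [show k + m + 1 - (k + 1) = m by omega] at h2
  rw [show k + m + 1 - k = m + 1 by omega] at h3
  refine mul_right_cancel₀ (mul_ne_zero (qpoch_ne_zero (k + 1)) (qpoch_ne_zero (m + 1))) ?_
  rw [h1, qpoch_succ (k + m + 1)]
  have e1 := qpoch_succ k
  have e2 := qpoch_succ m
  rw [add_mul, e2, show ∀ a b c d : Polynomial ℤ, a * (b * (c * d)) = a * (b * c) * d by
    intros; ring, h2, ← e2, e1, show ∀ a b c d e : Polynomial ℤ,
    a * b * (c * d * e) = b * (c * e) * (a * d) by intros; ring, h3]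
  ring

theorem isGaussBinom_of_qpoch
    (hqb0 : ∀ (n : ℕ) (k : ℤ), k < 0 ∨ (n : ℤ) < k → qbinom n k = 0)
    (hqb1 : ∀ n k : ℕ, k ≤ n → qbinom n k * (qpoch k * qpoch (n - k)) = qpoch n)
    {K : Type*} [Field K] (φ : Polynomial ℤ →+* K) :
    IsGaussBinom (φ Polynomial.X) fun n k => φ (qbinom n.toNat k) where
  pascal n k hn := by
    obtain ⟨n, rfl⟩ : ∃ m : ℕ, n = (m + 1 : ℕ) := ⟨(n - 1).toNat, by omega⟩
    have hn' : (((n + 1 : ℕ) : ℤ) - 1).toNat = n := by omega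
    simp only [hn', Int.toNat_natCast]
    rcases lt_or_ge k 0 with hk | hk
    · rw [hqb0 _ k (Or.inl hk), hqb0 _ k (Or.inl hk), hqb0 _ (k - 1) (Or.inl (by omega))]
      simp
    obtain ⟨k, rfl⟩ := Int.eq_ofNat_of_zero_le hk
    rcases Nat.eq_zero_or_pos k with rfl | hk0
    · rw [hqb0 n _ (Or.inl (show ((0 : ℕ) : ℤ) - 1 < 0 by simp)), Nat.cast_zero,
        qbinom_zero_right hqb1, qbinom_zero_right hqb1]
      simp
    obtain ⟨k, rfl⟩ : ∃ m, k = m + 1 := ⟨k - 1, by omega⟩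
    rw [show ((k + 1 : ℕ) : ℤ) - 1 = k by push_cast; ring]
    rcases lt_trichotomy n k with h | rfl | h
    · rw [hqb0 _ _ (Or.inr (by omega)), hqb0 _ _ (Or.inr (by omega)),
        hqb0 _ _ (Or.inr (by omega))]
      simp
    · rw [qbinom_self hqb1, qbinom_self hqb1, hqb0 _ _ (Or.inr (by omega))]
      simp
    · obtain ⟨m, rfl⟩ : ∃ m, n = k + m + 1 := ⟨n - k - 1, by omega⟩
      rw [qbinom_succ_succ hqb1, map_add, map_mul, map_pow, ← zpow_natCast]
      congr 3
      push_cast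
      ring
  eq_zero_of_neg n k _ hk := by rw [hqb0 _ _ (Or.inl hk), map_zero]
  eq_zero_of_lt n k hn hk := by rw [hqb0 _ _ (Or.inr (by omega)), map_zero]
  zero_right n _ := by rw [qbinom_zero_right hqb1, map_one]
  self n hn := by
    obtain ⟨n, rfl⟩ := Int.eq_ofNat_of_zero_le hn
    rw [Int.toNat_natCast, qbinom_self hqb1, map_one]

end GaussBinom

section Assembly

theorem sum_range_mul_sum_fiber {R ι κ : Type*} [CommSemiring R] (S : Finset ι) (T : Finset κ)
    {p q : ℕ} (d : ι → ℕ) (d' : κ → ℕ) (hd : ∀ u ∈ S, d u < p) (hd' : ∀ v ∈ T, d' v < q)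
    (c : ℕ → ℕ → R) (a : ι → R) (b : κ → R) :
    ∑ i ∈ Finset.range p, ∑ j ∈ Finset.range q,
        c i j * (∑ u ∈ S, if d u = i then a u else 0) * (∑ v ∈ T, if d' v = j then b v else 0) =
      ∑ u ∈ S, ∑ v ∈ T, c (d u) (d' v) * a u * b v := by
  have h1 : ∀ i j, c i j * (∑ u ∈ S, if d u = i then a u else 0) *
      (∑ v ∈ T, if d' v = j then b v else 0) =
      ∑ u ∈ S, ∑ v ∈ T, if d u = i then if d' v = j then c i j * a u * b v else 0 else 0 := by
    intro i j
    rw [mul_assoc, Finset.sum_mul_sum, Finset.mul_sum]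
    refine Finset.sum_congr rfl fun u _ => ?_
    rw [Finset.mul_sum]
    refine Finset.sum_congr rfl fun v _ => ?_
    split_ifs <;> simp [mul_assoc]
  simp_rw [h1]
  calc _ = ∑ u ∈ S, ∑ v ∈ T, ∑ i ∈ Finset.range p, ∑ j ∈ Finset.range q,
        if d u = i then if d' v = j then c i j * a u * b v else 0 else 0 := by
        simp_rw [Finset.sum_comm (s := Finset.range q) (t := S)]
        rw [Finset.sum_comm]
        refine Finset.sum_congr rfl fun u _ => ?_
        simp_rw [Finset.sum_comm (s := Finset.range q) (t := T)]
        rw [Finset.sum_comm]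
    _ = _ := by
        refine Finset.sum_congr rfl fun u hu => Finset.sum_congr rfl fun v hv => ?_
        rw [Finset.sum_eq_single (d u) (fun i _ hi => by simp [hi.symm])
          (fun h => (h (Finset.mem_range.2 (hd u hu))).elim),
          Finset.sum_eq_single (d' v) (fun i _ hi => by simp [hi.symm])
          (fun h => (h (Finset.mem_range.2 (hd' v hv))).elim)]
        simp

theorem length_of_mem_words {α : Type*} {S : Finset α} {l : List α} (hl : l ∈ words S) :
    l.length = S.card := by
  rw [mem_words] at hl
  rw [Finset.card_def, hl, Multiset.coe_card]

theorem mem_of_mem_words {α : Type*} {S : Finset α} {l : List α} (hl : l ∈ words S)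
    {a : α} (ha : a ∈ l) : a ∈ S := by
  rw [mem_words] at hl
  rwa [← Finset.mem_val, hl]

variable {α : Type*} [LinearOrder α]

theorem revDes_toNat_lt {S : Finset α} (hS : 0 < S.card) {l : List α} (hl : l ∈ words S) :
    (revDes l).toNat < S.card := by
  have h := length_of_mem_words hl
  cases l with
  | nil => simpa [revDes] using hS
  | cons a l =>
    have := revDes_cons_le a l
    rw [List.length_cons] at h
    omega

theorem map_Wpoly {n : ℕ} {K : Type*} [CommRing K] (φ : Polynomial ℤ →+* K)
    (lt : α → α → Prop) [Std.Irrefl lt] (g : Fin n ↪ α)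
    (lab : Fin n → ℕ) (hg : ∀ i j, lab i < lab j ↔ g i < g j) (s : ℕ) :
    φ (Wpoly n (fun a b => lt (g a) (g b)) lab s) =
      ∑ l ∈ words (Finset.univ.map g),
        if l.Pairwise (fun a b => ¬ lt a b) then descentTerm (φ Polynomial.X) s l else 0 := by
  rw [Wpoly_eq_sum_words lt g lab hg, map_sum]
  refine Finset.sum_congr rfl fun l _ => ?_
  simp only [descentTerm, apply_ite φ, map_pow, map_zero]

theorem map_Wpoly_eq_sum_fiber {n : ℕ} {K : Type*} [CommRing K] (φ : Polynomial ℤ →+* K)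
    (lt : α → α → Prop) [Std.Irrefl lt] (g : Fin n ↪ α)
    (lab : Fin n → ℕ) (hg : ∀ i j, lab i < lab j ↔ g i < g j) (s : ℕ) :
    φ (Wpoly n (fun a b => lt (g a) (g b)) lab s) =
      ∑ l ∈ words (Finset.univ.map g), if (revDes l).toNat = s then
        if l.Pairwise (fun a b => ¬ lt a b) then φ Polynomial.X ^ revMaj l else 0 else 0 := by
  rw [map_Wpoly φ lt g lab hg]
  refine Finset.sum_congr rfl fun l _ => ?_
  have := revDes_nonneg l
  have h : revDes l = s ↔ (revDes l).toNat = s := by omega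
  simp only [descentTerm, h]
  split_ifs <;> rfl

theorem map_shuffleCoeff {K : Type*} [Field K] (φ : Polynomial ℤ →+* K)
    {qbinom : ℕ → ℤ → Polynomial ℤ}
    (hqb0 : ∀ (n : ℕ) (k : ℤ), k < 0 ∨ (n : ℤ) < k → qbinom n k = 0)
    {p q i j : ℕ} (hi : i < p) (hj : j < q) (s : ℕ) :
    φ (Polynomial.X ^ ((s - i) * (s - j)) *
        qbinom (p + j - i) ((s : ℤ) - i) * qbinom (q + i - j) ((s : ℤ) - j)) =
      shuffleCoeff (φ Polynomial.X) (fun n k => φ (qbinom n.toNat k)) p q i j s := by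
  have h1 : ((p : ℤ) + j - i).toNat = p + j - i := by omega
  have h2 : ((q : ℤ) + i - j).toNat = q + i - j := by omega
  simp only [shuffleCoeff, h1, h2, map_mul, map_pow]
  rcases lt_or_ge s i with h | h
  · simp [hqb0 (p + j - i) ((s : ℤ) - i) (Or.inl (by omega))]
  rcases lt_or_ge s j with h' | h'
  · simp [hqb0 (q + i - j) ((s : ℤ) - j) (Or.inl (by omega))]
  rw [← zpow_natCast]
  push_cast [h, h']
  rfl

theorem sum_words_union_descentTerm {K : Type*} [Field K] {x : K} {G : ℤ → ℤ → K} (hx : x ≠ 0)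
    (hG : IsGaussBinom x G) (lt : α → α → Prop) {A B : Finset α} (hA : 0 < A.card)
    (hB : 0 < B.card) (hlt : ∀ a ∈ A, ∀ b ∈ B, a < b)
    (hAB : ∀ a ∈ A, ∀ b ∈ B, ¬ lt a b ∧ ¬ lt b a) (s : ℤ) :
    (∑ l ∈ words (A ∪ B),
        if l.Pairwise (fun a b => ¬ lt a b) then descentTerm x s l else 0) =
      ∑ u ∈ words A, ∑ v ∈ words B,
        shuffleCoeff x G A.card B.card (revDes u).toNat (revDes v).toNat s *
          (if u.Pairwise (fun a b => ¬ lt a b) then x ^ revMaj u else 0) *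
          (if v.Pairwise (fun a b => ¬ lt a b) then x ^ revMaj v else 0) := by
  have hdisj : Disjoint A B := Finset.disjoint_left.2 fun a ha hb => (hlt a ha a hb).false
  rw [sum_words_union hdisj]
  refine Finset.sum_congr rfl fun u hu => Finset.sum_congr rfl fun v hv => ?_
  have hu' := length_of_mem_words hu
  have hv' := length_of_mem_words hv
  rw [shuffleSum_ite_pairwise _ _ _ _ fun a ha b hb =>
      hAB a (mem_of_mem_words hu ha) b (mem_of_mem_words hv hb),
    shuffleSum_descentTerm hx hG (by rintro rfl; simp at hu'; omega)
      (by rintro rfl; simp at hv'; omega)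
      (fun a ha b hb => hlt a (mem_of_mem_words hu ha) b (mem_of_mem_words hv hb)),
    hu', hv', Int.toNat_of_nonneg (revDes_nonneg u), Int.toNat_of_nonneg (revDes_nonneg v),
    ite_and]
  split_ifs <;> ring

end Assembly

/-- **Stanley, Proposition 12.6** : if no element of `A = {1,…,p}` is comparable
to any element of `B = {p+1,…,p+q}` in the partial order `⪯` on `[p+q]`, then
`W_s(⪯) = ∑_{i=0}^{p-1} ∑_{j=0}^{q-1} x^{(s-i)(s-j)} binom(p+j-i, s-i) binom(q+i-j, s-j)
W_i(⪯|_A) W_j(⪯|_B)`, where `binom` is the Gaussian binomial coefficient in `x`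
(vanishing when its lower argument is negative or exceeds its upper argument),
here pinned down by the defining identity `binom(n,k) (q)_k (q)_{n-k} = (q)_n`. -/
theorem Wpoly_disjoint_union (p q : ℕ) (hp : 0 < p) (hq : 0 < q)
    (P : PartialOrder (Fin (p + q)))
    (hAB : ∀ i j : Fin (p + q), (i : ℕ) < p → p ≤ (j : ℕ) →
      ¬ P.lt i j ∧ ¬ P.lt j i)
    (qbinom : ℕ → ℤ → Polynomial ℤ)
    (hqb0 : ∀ (n : ℕ) (k : ℤ), k < 0 ∨ (n : ℤ) < k → qbinom n k = 0)
    (hqb1 : ∀ n k : ℕ, k ≤ n → qbinom n k * (qpoch k * qpoch (n - k)) = qpoch n)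
    (s : ℕ) :
    Wpoly (p + q) P.lt (fun i => (i : ℕ) + 1) s =
      ∑ i ∈ Finset.range p, ∑ j ∈ Finset.range q,
        Polynomial.X ^ ((s - i) * (s - j)) *
          qbinom (p + j - i) ((s : ℤ) - i) * qbinom (q + i - j) ((s : ℤ) - j) *
          Wpoly p (fun a b : Fin p =>
              P.lt (Fin.castLE (Nat.le_add_right p q) a)
                (Fin.castLE (Nat.le_add_right p q) b)) (fun a => (a : ℕ) + 1) i *
          Wpoly q (fun a b : Fin q => P.lt (Fin.natAdd p a) (Fin.natAdd p b))
            (fun a => p + (a : ℕ) + 1) j := by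
  let φ := algebraMap (Polynomial ℤ) (FractionRing (Polynomial ℤ))
  have hinj : Function.Injective φ := IsFractionRing.injective _ _
  have hx : φ Polynomial.X ≠ 0 := (map_ne_zero_iff φ hinj).2 Polynomial.X_ne_zero
  have hG := isGaussBinom_of_qpoch hqb0 hqb1 φ
  have hirr : Std.Irrefl P.lt := ⟨fun a => @lt_irrefl _ P.toPreorder a⟩
  let gA : Fin p ↪ Fin (p + q) := Fin.castLEEmb (Nat.le_add_right p q)
  let gB : Fin q ↪ Fin (p + q) := Fin.natAddEmb p
  have hmemA : ∀ a ∈ Finset.univ.map gA, (a : ℕ) < p := by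
    intro a ha
    obtain ⟨i, -, rfl⟩ := Finset.mem_map.1 ha
    exact i.2
  have hmemB : ∀ a ∈ Finset.univ.map gB, p ≤ (a : ℕ) := by
    intro a ha
    obtain ⟨i, -, rfl⟩ := Finset.mem_map.1 ha
    exact Nat.le_add_right p i
  have hunion : Finset.univ.map (Function.Embedding.refl (Fin (p + q))) =
      Finset.univ.map gA ∪ Finset.univ.map gB := by
    refine (Finset.eq_univ_of_forall fun a => ?_).trans
      (Finset.eq_univ_of_forall fun a => ?_).symm
    · simp
    · rcases lt_or_ge (a : ℕ) p with h | h
      · exact Finset.mem_union_left _ (Finset.mem_map.2 ⟨⟨a, h⟩, Finset.mem_univ _, rfl⟩)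
      · refine Finset.mem_union_right _
          (Finset.mem_map.2 ⟨⟨a - p, by omega⟩, Finset.mem_univ _, Fin.ext ?_⟩)
        exact Nat.add_sub_cancel' h
  have hcA : (Finset.univ.map gA).card = p := by simp
  have hcB : (Finset.univ.map gB).card = q := by simp
  have hW := map_Wpoly φ P.lt (Function.Embedding.refl (Fin (p + q)))
    (fun i => (i : ℕ) + 1) (fun i j => Nat.add_lt_add_iff_right) s
  have hWA := map_Wpoly_eq_sum_fiber φ P.lt gA (fun a => (a : ℕ) + 1)
    (fun i j => Nat.add_lt_add_iff_right)
  have hWB := map_Wpoly_eq_sum_fiber φ P.lt gB (fun a => p + (a : ℕ) + 1)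
    (fun i j => Nat.add_lt_add_iff_right)
  rw [hunion, sum_words_union_descentTerm hx hG P.lt (by omega) (by omega)
    (fun a ha b hb => Fin.lt_def.2 ((hmemA a ha).trans_le (hmemB b hb)))
    (fun a ha b hb => hAB a b (hmemA a ha) (hmemB b hb)), hcA, hcB] at hW
  refine hinj (hW.trans ?_)
  rw [map_sum]
  simp_rw [map_sum]
  rw [← sum_range_mul_sum_fiber (p := p) (q := q) _ _ _ _
    (fun u hu => (revDes_toNat_lt (by omega) hu).trans_eq hcA)
    (fun v hv => (revDes_toNat_lt (by omega) hv).trans_eq hcB)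
    (fun i j => shuffleCoeff (φ Polynomial.X) (fun n k => φ (qbinom n.toNat k)) p q i j s)]
  refine Finset.sum_congr rfl fun i hi => Finset.sum_congr rfl fun j hj => ?_
  rw [← hWA, ← hWB, ← map_shuffleCoeff φ hqb0 (Finset.mem_range.1 hi) (Finset.mem_range.1 hj),
    ← map_mul, ← map_mul]
  rfl
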